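/- Let d ≥ 1, and for each k ∈ {1,…,d} let Γ_k ⊆ ℝ be a finite nonempty set of grid coordinates. Let S be a finite family of closed axis-aligned boxes in ℝ^d, each stabbed along every axis. Say two boxes of S are equivalent if they intersect exactly the same set of grid cells, and let rep : S → S be a function with rep(s) equivalent to s for every s ∈ S. Let P ⊆ ℝ^d be a finite set of points such that for every s ∈ S the box rep(s) contains a point of P. Let P′ be the set of all corners of the grid cells that contain a point of P. Then every box s ∈ S contains a point of P′, and |P′| ≤ 2^d·|P|. -/

import Mathlib

/-- Two reals lie in the same grid column determined by the finite set `Γ` of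
grid coordinates (the columns are the half-open intervals into which the points
of `Γ` subdivide `ℝ`). -/
def SameCol (Γ : Finset ℝ) (x y : ℝ) : Prop := ∀ γ ∈ Γ, (γ ≤ x ↔ γ ≤ y)

/-- `e` is a finite endpoint (an element of `Γ`) of the column containing `x`:
either the greatest grid coordinate `≤ x` or the least grid coordinate `> x`. -/
def IsColEndpoint (Γ : Finset ℝ) (x e : ℝ) : Prop :=
  e ∈ Γ ∧ ((e ≤ x ∧ ∀ γ ∈ Γ, γ ≤ x → γ ≤ e) ∨ (x < e ∧ ∀ γ ∈ Γ, x < γ → e ≤ γ))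

/-- The closed axis-aligned box `∏ₖ [s.1 k, s.2 k]`. -/
def boxSet {d : ℕ} (s : (Fin d → ℝ) × (Fin d → ℝ)) : Set (Fin d → ℝ) :=
  {x | ∀ k, s.1 k ≤ x k ∧ x k ≤ s.2 k}

/-- The grid cell (w.r.t. the grid coordinates `Γ k` on the `k`-th axis)
containing the point `p`. -/
def cellOf {d : ℕ} (Γ : Fin d → Finset ℝ) (p : Fin d → ℝ) : Set (Fin d → ℝ) :=
  {q | ∀ k, SameCol (Γ k) (p k) (q k)}

theorem SameCol.isColEndpoint_iff {Γ : Finset ℝ} {x y : ℝ} (h : SameCol Γ x y) (e : ℝ) :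
    IsColEndpoint Γ x e ↔ IsColEndpoint Γ y e := by
  have h' : ∀ γ ∈ Γ, (x < γ ↔ y < γ) := fun γ hγ => by
    simpa only [not_le] using not_congr (h γ hγ)
  refine and_congr_right fun he => or_congr (and_congr (h e he) ?_) (and_congr (h' e he) ?_)
  · exact forall₂_congr fun γ hγ => imp_congr_left (h γ hγ)
  · exact forall₂_congr fun γ hγ => imp_congr_left (h' γ hγ)

/-- A closed interval that contains `x` and a grid coordinate contains an endpoint of the column
of `x`. -/
theorem exists_isColEndpoint_mem_Icc {Γ : Finset ℝ} {l r x γ : ℝ} (hγ : γ ∈ Γ)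
    (hlγ : l ≤ γ) (hγr : γ ≤ r) (hlx : l ≤ x) (hxr : x ≤ r) :
    ∃ e, IsColEndpoint Γ x e ∧ l ≤ e ∧ e ≤ r := by
  rcases le_or_gt γ x with h | h
  · obtain ⟨e, he, hmax⟩ := (Γ.filter (· ≤ x)).exists_max_image id
      ⟨γ, Finset.mem_filter.2 ⟨hγ, h⟩⟩
    simp only [Finset.mem_filter, id, and_imp] at he hmax
    exact ⟨e, ⟨he.1, .inl ⟨he.2, hmax⟩⟩, hlγ.trans (hmax γ hγ h), he.2.trans hxr⟩
  · obtain ⟨e, he, hmin⟩ := (Γ.filter (x < ·)).exists_min_image id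
      ⟨γ, Finset.mem_filter.2 ⟨hγ, h⟩⟩
    simp only [Finset.mem_filter, id, and_imp] at he hmin
    exact ⟨e, ⟨he.1, .inr ⟨he.2, hmin⟩⟩, hlx.trans he.2.le, (hmin γ hγ h).trans hγr⟩

open Classical in
theorem card_filter_isColEndpoint_le_two (Γ : Finset ℝ) (x : ℝ) :
    (Γ.filter (IsColEndpoint Γ x)).card ≤ 2 := by
  by_contra! h
  obtain ⟨a, b, c, ha, hb, hc, hab, hac, hbc⟩ := Finset.two_lt_card_iff.1 h
  have key : ∀ {u v : ℝ}, IsColEndpoint Γ x u → IsColEndpoint Γ x v →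
      (u ≤ x ↔ v ≤ x) → u = v := by
    rintro u v ⟨hu, ⟨hux, hu'⟩ | ⟨hux, hu'⟩⟩ ⟨hv, ⟨hvx, hv'⟩ | ⟨hvx, hv'⟩⟩ huv
    · exact le_antisymm (hv' u hu hux) (hu' v hv hvx)
    · exact absurd (huv.1 hux) hvx.not_ge
    · exact absurd (huv.2 hvx) hux.not_ge
    · exact le_antisymm (hu' v hv hvx) (hv' u hu hux)
  have hab' := mt (key (Finset.mem_filter.1 ha).2 (Finset.mem_filter.1 hb).2) hab
  have hac' := mt (key (Finset.mem_filter.1 ha).2 (Finset.mem_filter.1 hc).2) hac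
  have hbc' := mt (key (Finset.mem_filter.1 hb).2 (Finset.mem_filter.1 hc).2) hbc
  tauto

/-- Rounding lemma for piercing boxes: if every box of `S` is stabbed along
every axis, `rep` sends each box of `S` to a box of `S` intersecting exactly the
same grid cells, and the finite point set `P` pierces all the representative
boxes, then the set `P'` of all corners of the grid cells containing a point of
`P` pierces every box of `S`, and `|P'| ≤ 2^d·|P|`. -/
theorem stmt1 (d : ℕ) (hd : 1 ≤ d) (Γ : Fin d → Finset ℝ) (hΓ : ∀ k, (Γ k).Nonempty)
    (S : Finset ((Fin d → ℝ) × (Fin d → ℝ)))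
    (hstab : ∀ s ∈ S, ∀ k, ∃ γ ∈ Γ k, s.1 k ≤ γ ∧ γ ≤ s.2 k)
    (rep : (Fin d → ℝ) × (Fin d → ℝ) → (Fin d → ℝ) × (Fin d → ℝ))
    (hrepS : ∀ s ∈ S, rep s ∈ S)
    (hrep : ∀ s ∈ S, ∀ p : Fin d → ℝ,
      ((boxSet s ∩ cellOf Γ p).Nonempty ↔ (boxSet (rep s) ∩ cellOf Γ p).Nonempty))
    (P : Finset (Fin d → ℝ))
    (hP : ∀ s ∈ S, ∃ pt ∈ P, pt ∈ boxSet (rep s))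
    (P' : Set (Fin d → ℝ))
    (hP' : P' = {q | ∃ pt ∈ P, ∀ k, IsColEndpoint (Γ k) (pt k) (q k)}) :
    (∀ s ∈ S, ∃ q ∈ P', q ∈ boxSet s) ∧ P'.Finite ∧ P'.ncard ≤ 2 ^ d * P.card := by
  classical
  subst hP'
  refine ⟨fun s hs => ?_, ?_⟩
  · obtain ⟨pt, hpt, hmem⟩ := hP s hs
    obtain ⟨y, hy, hcell⟩ := (hrep s hs pt).2 ⟨pt, hmem, fun k γ _ => Iff.rfl⟩
    have hcorner : ∀ k, ∃ e, IsColEndpoint (Γ k) (y k) e ∧ s.1 k ≤ e ∧ e ≤ s.2 k := fun k => by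
      obtain ⟨γ, hγ, hlγ, hγr⟩ := hstab s hs k
      exact exists_isColEndpoint_mem_Icc hγ hlγ hγr (hy k).1 (hy k).2
    choose q hq hqs using hcorner
    exact ⟨q, ⟨pt, hpt, fun k => ((hcell k).isColEndpoint_iff (q k)).2 (hq k)⟩, hqs⟩
  · have hcorners : {q : Fin d → ℝ | ∃ pt ∈ P, ∀ k, IsColEndpoint (Γ k) (pt k) (q k)} =
        ↑(P.biUnion fun pt => Fintype.piFinset fun k =>
          (Γ k).filter (IsColEndpoint (Γ k) (pt k))) := by
      ext q
      simp only [Set.mem_ofPred_eq, Finset.coe_biUnion, Set.mem_iUnion, Finset.mem_coe,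
        Fintype.mem_piFinset, Finset.mem_filter, exists_prop]
      exact exists_congr fun pt => and_congr_right fun _ =>
        forall_congr' fun k => ⟨fun h => ⟨h.1, h⟩, fun h => h.2⟩
    rw [hcorners]
    refine ⟨Finset.finite_toSet _, ?_⟩
    rw [Set.ncard_coe_finset, mul_comm]
    refine Finset.card_biUnion_le_card_mul _ _ _ fun pt _ => ?_
    rw [Fintype.card_piFinset]
    refine (Finset.prod_le_pow_card _ _ 2 fun k _ =>
      card_filter_isColEndpoint_le_two (Γ k) (pt k)).trans_eq ?_
    simp
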